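/- Let T be a finite transitive oriented graph such that B(T) admits a bipartite Min-Max ordering and T contains no induced subdigraph isomorphic to O_1, O_2, O_3 or O_4. Then T admits a Min-Max ordering. -/

import Mathlib

/-- Common arc set of the obstructions `O_1, …, O_4`, on vertex set `Fin 6`
(vertex `i+1` of the paper is `i : Fin 6` here): arcs 13,14,15,16,24,25,26,36,45,46. -/
def Obase : Fin 6 → Fin 6 → Prop := fun u v =>
  (u, v) ∈ ([(0, 2), (0, 3), (0, 4), (0, 5), (1, 3), (1, 4), (1, 5), (2, 5), (3, 4), (3, 5)] :
    List (Fin 6 × Fin 6))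

/-- Arc relation of `O_{i+1}` for `i : Fin 4`:
`S_1 = ∅`, `S_2 = {12}`, `S_3 = {56}`, `S_4 = {12, 56}`. -/
def Oarc : Fin 4 → Fin 6 → Fin 6 → Prop := fun i u v =>
  Obase u v ∨ ((i = 1 ∨ i = 3) ∧ (u, v) = (0, 1)) ∨ ((i = 2 ∨ i = 3) ∧ (u, v) = (4, 5))

/-- A pair of injective labellings of the tails and the heads of `A` that is a bipartite
Min-Max ordering of the bipartite graph associated with `A`. -/
structure IsMinMaxPair {V : Type} (A : V → V → Prop) (f g : V → ℤ) : Prop where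
  injective_left : Function.Injective f
  injective_right : Function.Injective g
  cross : ∀ i j s r : V, f i < f j → g s < g r → A i r → A j s → A i s ∧ A j r

namespace IsMinMaxPair

variable {V : Type} {A : V → V → Prop} {f g : V → ℤ}

theorem neg (h : IsMinMaxPair A f g) : IsMinMaxPair A (-f) (-g) where
  injective_left := neg_injective.comp h.injective_left
  injective_right := neg_injective.comp h.injective_right
  cross i j s r hij hsr hir hjs := by
    simp only [Pi.neg_apply, neg_lt_neg_iff] at hij hsr
    exact (h.cross j i r s hij hsr hjs hir).symm

theorem lt_iff_lt (h : IsMinMaxPair A f g) {i j r s : V} (hir : A i r) (hjs : A j s)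
    (hn : ¬ (A i s ∧ A j r)) : f i < f j ↔ g r < g s := by
  have hrs : g r ≠ g s := fun e => hn (by
    obtain rfl := h.injective_right e; exact ⟨hir, hjs⟩)
  have hij : f i ≠ f j := fun e => hn (by
    obtain rfl := h.injective_left e; exact ⟨hjs, hir⟩)
  have h1 := fun p q => hn (h.cross i j s r p q hir hjs)
  have h2 := fun p q => hn (h.cross j i r s p q hjs hir).symm
  grind

section Conflict

variable [IsTrans V A] [Std.Irrefl A]

/-- Comparable elements, neither minimal nor maximal, are ordered in the same way on both sides. -/
theorem lt_iff_lt_of_rel (h : IsMinMaxPair A f g) {a x y b : V} (hax : A a x) (hxy : A x y)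
    (hyb : A y b) : f x < f y ↔ g x < g y := by
  have tr : ∀ {u v w}, A u v → A v w → A u w := fun p q => _root_.trans p q
  have ir : ∀ u, ¬ A u u := irrefl
  have h1 := h.lt_iff_lt hxy hyb (fun t => ir _ t.2)
  have h2 := h.lt_iff_lt (tr hax hxy) hyb (fun t => ir _ t.2)
  have h3 := h.lt_iff_lt hax hyb (fun t => ir _ (tr hxy t.2))
  have h4 := h.lt_iff_lt hax (tr hxy hyb) (fun t => ir _ t.2)
  have h5 := h.lt_iff_lt hax hxy (fun t => ir _ t.2)
  tauto

/-- If two labellings order `x` and `y` differently while the first arcs through `x` are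
increasing, then the neighbourhoods of `y` are contained in those of `x`, and strictness of both
inclusions yields the arcs and non-arcs of an obstruction. -/
theorem obstruction_of_forward (h : IsMinMaxPair A f g) {x y a b c d : V}
    (hf : f x < f y) (hg : g y < g x) (hnxy : ¬ A x y) (hnyx : ¬ A y x)
    (hax : A a x) (hxb : A x b) (hcy : A c y) (hyd : A y d)
    (hac : ¬ A a y ∨ ¬ A c x) (hbd : ¬ A y b ∨ ¬ A x d) (hfw : f a < f x) :
    ¬ A a y ∧ ¬ A y b ∧ A c x ∧ A x d := by
  have tr : ∀ {u v w}, A u v → A v w → A u w := fun p q => _root_.trans p q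
  have ir : ∀ u, ¬ A u u := irrefl
  have hxb' := (h.lt_iff_lt hax hxb (fun t => ir _ t.2)).1 hfw
  have hxd := (h.lt_iff_lt hax hyd (fun t => hnyx t.2)).1 (hfw.trans hf)
  have hcx := (h.lt_iff_lt hcy hxb (fun t => hnxy t.2)).2 (hg.trans hxb')
  have hcx' : A c x := by
    by_contra hn
    have h1 := (h.lt_iff_lt hcy hax (fun t => hn t.1)).2 hg
    exact hn (h.cross c a x d h1 hxd (tr hcy hyd) hax).1
  have hxd' : A x d := by
    by_contra hn
    have h1 := (h.lt_iff_lt hxb hyd (fun t => hn t.1)).1 hf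
    exact hn (h.cross c x b d hcx h1 (tr hcy hyd) hxb).2
  tauto

theorem not_forward_of_not_rel (h : IsMinMaxPair A f g) {x y a b c d : V}
    (hf : f x < f y) (hg : g y < g x) (hnxy : ¬ A x y) (hnyx : ¬ A y x)
    (hax : A a x) (hxb : A x b) (hcy : A c y) (hyd : A y d)
    (hcx : ¬ A c x) (hbd : ¬ A y b ∨ ¬ A x d) : ¬ f c < f y := by
  intro hfw
  have tr : ∀ {u v w}, A u v → A v w → A u w := fun p q => _root_.trans p q
  have ir : ∀ u, ¬ A u u := irrefl
  have hca := (h.lt_iff_lt hcy hax (fun t => hcx t.1)).2 hg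
  have hdx := (h.lt_iff_lt (tr hcy hyd) hax (fun t => hcx t.1)).1 hca
  have hya := (h.lt_iff_lt hyd hax (fun t => hnyx t.1)).2 hdx
  have hyd' := (h.lt_iff_lt hcy hyd (fun t => ir _ t.2)).1 hfw
  have key := h.lt_iff_lt hcy hxb (fun t => hnxy t.2)
  have hyb : A y b := by
    by_contra hn
    have h1 := (h.lt_iff_lt hxb hyd (fun t => hn t.2)).1 hf
    exact hn (h.cross y a b d hya h1 hyd (tr hax hxb)).1
  have hyb' := (h.lt_iff_lt hcy hyb (fun t => ir _ t.2)).1 hfw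
  have hxd : ¬ A x d := by tauto
  have h1 := (h.lt_iff_lt hxb hyd (fun t => hxd t.1)).1 hf
  exact hxd (h.cross c x b d (key.2 hyb') h1 (tr hcy hyd) hxb).2

theorem not_forward_of_backward (h : IsMinMaxPair A f g) {x y a b c d : V}
    (hf : f x < f y) (hg : g y < g x) (hnxy : ¬ A x y) (hnyx : ¬ A y x)
    (hax : A a x) (hxb : A x b) (hcy : A c y) (hyd : A y d)
    (hac : ¬ A a y ∨ ¬ A c x) (hbd : ¬ A y b ∨ ¬ A x d) (hbw : f x < f a) : ¬ f c < f y := by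
  rcases hac with hay | hcx
  · intro _
    exact h.neg.not_forward_of_not_rel (neg_lt_neg hf) (neg_lt_neg hg) hnyx hnxy hcy hyd
      hax hxb hay hbd.symm (neg_lt_neg hbw)
  · exact h.not_forward_of_not_rel hf hg hnxy hnyx hax hxb hcy hyd hcx hbd

/-- The arcs and non-arcs common to the four obstructions, at a pair `y`, `x` of
incomparable elements. -/
theorem exists_embedding (h : IsMinMaxPair A f g) {x y a b c d : V}
    (hf : f x < f y) (hg : g y < g x) (hnxy : ¬ A x y) (hnyx : ¬ A y x)
    (hax : A a x) (hxb : A x b) (hcy : A c y) (hyd : A y d)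
    (hac : ¬ A a y ∨ ¬ A c x) (hbd : ¬ A y b ∨ ¬ A x d) :
    (¬ A a y ∧ ¬ A y b ∧ A c x ∧ A x d) ∨ (¬ A c x ∧ ¬ A x d ∧ A a y ∧ A y b) := by
  have ir : ∀ u, ¬ A u u := irrefl
  have hne : f a ≠ f x := fun e => by
    obtain rfl := h.injective_left e; exact ir _ hax
  have hne' : f c ≠ f y := fun e => by
    obtain rfl := h.injective_left e; exact ir _ hcy
  rcases hne.lt_or_gt with hfw | hbw
  · exact .inl (h.obstruction_of_forward hf hg hnxy hnyx hax hxb hcy hyd hac hbd hfw)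
  · have h1 := h.not_forward_of_backward hf hg hnxy hnyx hax hxb hcy hyd hac hbd hbw
    exact .inr (h.neg.obstruction_of_forward (neg_lt_neg hf) (neg_lt_neg hg) hnyx hnxy hcy hyd
      hax hxb hac.symm hbd.symm (neg_lt_neg (lt_of_le_of_ne (not_lt.1 h1) hne'.symm)))

end Conflict

end IsMinMaxPair

/-- An incomparable pair `x`, `y` with properly nested neighbourhoods on both sides spans an
induced copy of one of the obstructions. -/
theorem exists_induced_Oarc {V : Type} {A : V → V → Prop} [IsTrans V A] [Std.Irrefl A]
    {x y a b c d : V} (hnxy : ¬ A x y) (hnyx : ¬ A y x)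
    (hax : A a x) (hxb : A x b) (hcy : A c y) (hyd : A y d)
    (hay : ¬ A a y) (hyb : ¬ A y b) (hcx : A c x) (hxd : A x d) :
    ∃ i : Fin 4, ∃ φ : Fin 6 → V, Function.Injective φ ∧
      ∀ u v : Fin 6, Oarc i u v ↔ A (φ u) (φ v) := by
  have tr : ∀ {u v w}, A u v → A v w → A u w := fun p q => _root_.trans p q
  have ir : ∀ u, ¬ A u u := irrefl
  have asy : ∀ {u v}, A u v → ¬ A v u := fun p q => ir _ (tr p q)
  have hac : ¬ A a c := fun t => hay (tr t hcy)
  have hdb : ¬ A d b := fun t => hyb (tr hyd t)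
  have hab := tr hax hxb
  have had := tr hax hxd
  have hcb := tr hcx hxb
  have hcd := tr hcx hxd
  have hinj : Function.Injective ![c, a, y, x, b, d] := by
    have hne : ∀ {u v}, A u v → u ≠ v := fun p e => ir _ (e ▸ p)
    have e1 : c ≠ a := fun e => hay (e ▸ hcy)
    have e2 : y ≠ x := fun e => hyb (e ▸ hxb)
    have e3 : b ≠ d := fun e => hyb (e ▸ hyd)
    have e4 : a ≠ y := fun e => hnyx (e ▸ hax)
    have e5 : y ≠ b := fun e => hnxy (e ▸ hxb)
    intro u v
    fin_cases u <;> fin_cases v <;>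
      simp [e1, e2, e3, e4, e5, e1.symm, e2.symm, e3.symm, e4.symm, e5.symm, hne hcy, hne hcx,
        hne hcb, hne hcd, hne hax, hne hab, hne had, hne hyd, hne hxb, hne hxd, (hne hcy).symm,
        (hne hcx).symm, (hne hcb).symm, (hne hcd).symm, (hne hax).symm, (hne hab).symm,
        (hne had).symm, (hne hyd).symm, (hne hxb).symm, (hne hxd).symm]
  have hya : ¬ A y a := fun t => hnyx (tr t hax)
  have hby : ¬ A b y := fun t => hnxy (tr hxb t)
  by_cases hca : A c a <;> by_cases hbd : A b d
  · refine ⟨3, _, hinj, fun u v => ?_⟩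
    fin_cases u <;> fin_cases v <;> simp [Oarc, Obase, *]
  · refine ⟨1, _, hinj, fun u v => ?_⟩
    fin_cases u <;> fin_cases v <;> simp [Oarc, Obase, *]
  · refine ⟨2, _, hinj, fun u v => ?_⟩
    fin_cases u <;> fin_cases v <;> simp [Oarc, Obase, *]
  · refine ⟨0, _, hinj, fun u v => ?_⟩
    fin_cases u <;> fin_cases v <;> simp [Oarc, Obase, *]

/-- The strict order by tails, with elements of equal out-neighbourhoods tied. -/
def TailLT {V : Type} (A : V → V → Prop) (f : V → ℤ) (x y : V) : Prop :=
  f x < f y ∧ A x ≠ A y ∧ (∃ b, A x b) ∧ ∃ b, A y b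

namespace IsMinMaxPair

variable {V : Type} {A : V → V → Prop} {f g : V → ℤ}

theorem flip (h : IsMinMaxPair A f g) : IsMinMaxPair (flip A) g f where
  injective_left := h.injective_right
  injective_right := h.injective_left
  cross i j s r hij hsr hir hjs := (h.cross s r i j hsr hij hjs hir)

/-- Elements with equal out-neighbourhoods are consecutive among the non-maximal ones. -/
theorem tail_eq_of_between (h : IsMinMaxPair A f g) {x y z : V} (hxz : f x < f z) (hzy : f z < f y)
    (hxy : A x = A y) (hz : ∃ b, A z b) (hx : ∃ b, A x b) : A x = A z := by
  obtain ⟨b₀, hb₀⟩ := hz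
  obtain ⟨c₀, hc₀⟩ := hx
  have key : ∀ b c, A x b → A z c → A x c ∧ A z b := by
    intro b c hb hc
    by_contra hn
    have h1 := (h.lt_iff_lt hb hc hn).1 hxz
    have h2 := (h.lt_iff_lt hc (hxy ▸ hb : A y b) (hxy ▸ fun t => hn t.symm)).1 hzy
    exact lt_asymm h1 h2
  ext w
  exact ⟨fun t => (key w b₀ t hb₀).2, fun t => (key c₀ w hc₀ t).1⟩

theorem tailLT_trans (h : IsMinMaxPair A f g) {x y z : V} (hxy : TailLT A f x y)
    (hyz : TailLT A f y z) : TailLT A f x z :=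
  ⟨hxy.1.trans hyz.1, fun e => hxy.2.1 (h.tail_eq_of_between hxy.1 hyz.1 e hxy.2.2.2 hxy.2.2.1),
    hxy.2.2.1, hyz.2.2.2⟩

/-- Negative transitivity of `TailLT` on the non-maximal elements. -/
theorem tailLT_of_not_tailLT (h : IsMinMaxPair A f g) {x y z : V} (hx : ∃ b, A x b)
    (hyx : ¬ TailLT A f y x) (hyz : TailLT A f y z) : TailLT A f x z := by
  by_cases e : A x = A y
  · have hne : A x ≠ A z := e ▸ hyz.2.1
    refine ⟨?_, hne, hx, hyz.2.2.2⟩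
    by_contra hlt
    rcases (not_lt.1 hlt).lt_or_eq with hzx | hzx
    · exact hyz.2.1 (h.tail_eq_of_between hyz.1 hzx e.symm hyz.2.2.2 hyz.2.2.1)
    · exact hne (by rw [h.injective_left hzx])
  · refine h.tailLT_trans ⟨?_, e, hx, hyz.2.2.1⟩ hyz
    by_contra hlt
    rcases (not_lt.1 hlt).lt_or_eq with hlt | heq
    · exact hyx ⟨hlt, Ne.symm e, hyz.2.2.1, hx⟩
    · exact e (by rw [h.injective_left heq])

/-- If no two elements are ordered differently by tails and by heads, both orders have a common
linear extension. -/
theorem exists_common_extension [Fintype V] (h : IsMinMaxPair A f g)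
    (hc : ∀ x y, TailLT A f x y → ¬ TailLT (_root_.flip A) g y x) :
    ∃ k : V → ℕ, Function.Injective k ∧ (∀ x y, TailLT A f x y → k x < k y) ∧
      ∀ x y, TailLT (_root_.flip A) g x y → k x < k y := by
  set F := TailLT A f with hF
  set G := TailLT (_root_.flip A) g with hG
  have tF : ∀ {x y z}, F x y → F y z → F x z := h.tailLT_trans
  have tG : ∀ {x y z}, G x y → G y z → G x z := h.flip.tailLT_trans
  -- A conflict-free step between middle elements can be absorbed by either order
  have hFGF : ∀ {w x y z}, F w x → G x y → F y z → F w z := fun h1 h2 h3 =>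
    tF h1 (h.tailLT_of_not_tailLT h1.2.2.2 (fun t => hc _ _ t h2) h3)
  have hGFG : ∀ {w x y z}, G w x → F x y → G y z → G w z := fun h1 h2 h3 =>
    tG h1 (h.flip.tailLT_of_not_tailLT h1.2.2.2 (fun t => hc _ _ h2 t) h3)
  have hT : ∀ x y, Relation.TransGen (fun x y => F x y ∨ G x y) x y →
      F x y ∨ G x y ∨ (∃ m, F x m ∧ G m y) ∨ ∃ m, G x m ∧ F m y := by
    intro x y hxy
    induction hxy with
    | single h => tauto
    | tail _ h2 ih =>
      rcases ih with i | i | ⟨m, i, j⟩ | ⟨m, i, j⟩ <;> rcases h2 with k | k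
      · exact .inl (tF i k)
      · exact .inr (.inr (.inl ⟨_, i, k⟩))
      · exact .inr (.inr (.inr ⟨_, i, k⟩))
      · exact .inr (.inl (tG i k))
      · exact .inl (hFGF i j k)
      · exact .inr (.inr (.inl ⟨_, i, tG j k⟩))
      · exact .inr (.inr (.inr ⟨_, i, tF j k⟩))
      · exact .inr (.inl (hGFG i j k))
  have hirr : ∀ x, ¬ Relation.TransGen (fun x y => F x y ∨ G x y) x x := by
    intro x hx
    rcases hT x x hx with i | i | ⟨m, i, j⟩ | ⟨m, i, j⟩
    · exact lt_irrefl _ i.1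
    · exact lt_irrefl _ i.1
    · exact hc _ _ i j
    · exact hc _ _ j i
  let P : PartialOrder V :=
    { le := Relation.ReflTransGen (fun x y => F x y ∨ G x y)
      le_refl := fun _ => .refl
      le_trans := fun _ _ _ => .trans
      le_antisymm := fun x y p q => by
        rcases Relation.reflTransGen_iff_eq_or_transGen.1 p with e | p
        · exact e.symm
        · exact (hirr _ (p.trans_left q)).elim }
  have : Fintype (LinearExtension V) := ‹Fintype V›
  let e := (Fintype.orderIsoFinOfCardEq (LinearExtension V) rfl).symm
  have hlt : ∀ x y, F x y ∨ G x y → (e (toLinearExtension x) : ℕ) < e (toLinearExtension y) := by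
    intro x y hxy
    have hle : x ≤ y := Relation.ReflTransGen.single hxy
    refine (e.monotone (toLinearExtension.monotone hle)).lt_of_ne fun he => ?_
    obtain rfl : x = y := e.injective he
    exact hirr x (.single hxy)
  exact ⟨fun x => e (toLinearExtension x), fun x y he => e.injective (Fin.val_injective he),
    fun x y t => hlt x y (.inl t), fun x y t => hlt x y (.inr t)⟩

end IsMinMaxPair

/-- A finite transitive oriented graph `T` such that `B(T)` admits a
bipartite Min-Max ordering and `T` has no induced subdigraph isomorphic to any `O_i`
admits a Min-Max ordering. -/
theorem stmt_7 {V : Type} [Fintype V] (A : V → V → Prop)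
    (hirr : ∀ v, ¬ A v v)
    (hasym : ∀ x y : V, A x y → ¬ A y x)
    (htrans : ∀ x y z : V, A x y → A y z → x ≠ z → A x z)
    (hbmm : ∃ (f g : V → ℕ), Function.Injective f ∧ Function.Injective g ∧
       ∀ i j s r : V, f i < f j → g s < g r → A i r → A j s → A i s ∧ A j r)
    (hO : ∀ i : Fin 4, ¬ ∃ φ : Fin 6 → V, Function.Injective φ ∧
       ∀ u v : Fin 6, Oarc i u v ↔ A (φ u) (φ v)) :
    ∃ h : V → ℕ, Function.Injective h ∧
      ∀ i j s r : V, h i < h j → h s < h r → A i r → A j s → A i s ∧ A j r := by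
  obtain ⟨f, g, hf, hg, hfg⟩ := hbmm
  have : IsTrans V A := ⟨fun x y z p q => htrans x y z p q (fun e => hasym x y p (e ▸ q))⟩
  have : Std.Irrefl A := ⟨hirr⟩
  have H : IsMinMaxPair A (fun v => (f v : ℤ)) (fun v => (g v : ℤ)) :=
    ⟨Nat.cast_injective.comp hf, Nat.cast_injective.comp hg, fun i j s r p q =>
      hfg i j s r (Int.ofNat_lt.1 p) (Int.ofNat_lt.1 q)⟩
  have hc : ∀ x y, TailLT A (fun v => (f v : ℤ)) x y →
      ¬ TailLT (flip A) (fun v => (g v : ℤ)) y x := by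
    rintro x y ⟨hfxy, hne, ⟨b₀, hb₀⟩, d₀, hd₀⟩ ⟨hgyx, hne', ⟨c₀, hc₀⟩, a₀, ha₀⟩
    have hnxy : ¬ A x y := fun t =>
      lt_asymm hgyx ((H.lt_iff_lt_of_rel ha₀ t hd₀).1 hfxy)
    have hnyx : ¬ A y x := fun t =>
      lt_asymm hfxy ((H.lt_iff_lt_of_rel hc₀ t hb₀).2 hgyx)
    obtain ⟨a, c, hax, hcy, hac⟩ : ∃ a c, A a x ∧ A c y ∧ (¬ A a y ∨ ¬ A c x) := by
      obtain ⟨p, hp⟩ := Function.ne_iff.1 hne'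
      simp only [flip] at hp hc₀ ha₀
      by_cases hpx : A p x
      · exact ⟨p, c₀, hpx, hc₀, .inl fun t => hp (by simp [t, hpx])⟩
      · exact ⟨a₀, p, ha₀, by_contra fun t => hp (by simp [t, hpx]), .inr hpx⟩
    obtain ⟨b, d, hxb, hyd, hbd⟩ : ∃ b d, A x b ∧ A y d ∧ (¬ A y b ∨ ¬ A x d) := by
      obtain ⟨p, hp⟩ := Function.ne_iff.1 hne
      by_cases hpx : A x p
      · exact ⟨p, d₀, hpx, hd₀, .inl fun t => hp (by simp [t, hpx])⟩
      · exact ⟨b₀, p, hb₀, by_contra fun t => hp (by simp [t, hpx]), .inr hpx⟩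
    rcases H.exists_embedding hfxy hgyx hnxy hnyx hax hxb hcy hyd hac hbd with
      ⟨h1, h2, h3, h4⟩ | ⟨h1, h2, h3, h4⟩
    · obtain ⟨i, hi⟩ := exists_induced_Oarc hnxy hnyx hax hxb hcy hyd h1 h2 h3 h4
      exact hO i hi
    · obtain ⟨i, hi⟩ := exists_induced_Oarc hnyx hnxy hcy hyd hax hxb h1 h2 h3 h4
      exact hO i hi
  obtain ⟨k, hk, hkF, hkG⟩ := H.exists_common_extension hc
  refine ⟨k, hk, fun i j s r hij hsr hir hjs => ?_⟩
  by_contra hn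
  have hfij : ¬ f j < f i := fun t => lt_asymm hij (hkF _ _ ⟨Int.ofNat_lt.2 t, fun e =>
    hn ⟨e ▸ hjs, e ▸ hir⟩, ⟨s, hjs⟩, r, hir⟩)
  have hgsr : ¬ g r < g s := fun t => lt_asymm hsr (hkG _ _ ⟨Int.ofNat_lt.2 t, fun e =>
    hn ⟨(congrFun e i).mp hir, (congrFun e j).mpr hjs⟩, ⟨i, hir⟩, j, hjs⟩)
  have hfij' : f i ≠ f j := fun e => hij.ne (congrArg k (hf e))
  have hgsr' : g s ≠ g r := fun e => hsr.ne (congrArg k (hg e))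
  exact hn (hfg i j s r (by omega) (by omega) hir hjs)
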